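/- Let κ be a regular infinite cardinal and λ an infinite cardinal. If there exists a κ-Lusin subset L ⊆ ω^ω of cardinality |L| ≥ cof(κ^λ), then there exists a monotone cofinal map from ω^ω to κ^λ (with the coordinatewise orders). -/

import Mathlib

/-- The cardinal `c` viewed as a (well-ordered) poset: the ordinals below `c.ord`. -/
abbrev CardPoset (c : Cardinal) := {o : Ordinal // o < c.ord}

/-- The cardinality hypothesis on a cofinal set turns into a surjection onto a cofinal set. -/
theorem exists_cofinal_enumeration {α : Type} {P : Type 1} [Preorder P] [Nonempty P]
    (hα : sInf {c : Cardinal | ∃ D : Set P, (∀ g : P, ∃ d ∈ D, g ≤ d) ∧ Cardinal.mk D = c} ≤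
      Cardinal.lift.{1} (Cardinal.mk α)) :
    ∃ φ : α → P, ∀ g, ∃ a, g ≤ φ a := by
  obtain ⟨D, hD, hcard⟩ := csInf_mem (s := {c : Cardinal | ∃ D : Set P,
    (∀ g : P, ∃ d ∈ D, g ≤ d) ∧ Cardinal.mk D = c})
    ⟨_, Set.univ, fun g => ⟨g, trivial, le_rfl⟩, rfl⟩
  rw [← hcard, ← Cardinal.lift_id'.{0, 1} (Cardinal.mk D), Cardinal.lift_mk_le'] at hα
  obtain ⟨e⟩ := hα
  have : Nonempty D := by
    obtain ⟨d, hd, -⟩ := hD (Classical.arbitrary P)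
    exact ⟨⟨d, hd⟩⟩
  refine ⟨fun a => (Function.invFun e a : D), fun g => ?_⟩
  obtain ⟨d, hd, hgd⟩ := hD g
  exact ⟨e ⟨d, hd⟩, by simpa [Function.leftInverse_invFun e.injective _] using hgd⟩

/-- If `κ` is a regular infinite cardinal, `λ` an infinite cardinal, and `L ⊆ ω^ω` is a
`κ`-Lusin set of cardinality at least `cof (κ^λ)`, then there is a monotone cofinal map
from `ω^ω` to `κ^λ` (with the coordinatewise orders). -/
theorem stmt_7 (κ lam : Cardinal.{0}) (hreg : κ.IsRegular)
    (hlam : Cardinal.aleph0 ≤ lam) (L : Set (ℕ → ℕ))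
    (hLusin : ∀ x : ℕ → ℕ, Cardinal.mk {y : ℕ → ℕ // y ∈ L ∧ y ≤ x} < κ)
    (hbig : sInf {c : Cardinal | ∃ D : Set (CardPoset lam → CardPoset κ),
        (∀ g : CardPoset lam → CardPoset κ, ∃ d ∈ D, g ≤ d) ∧ Cardinal.mk D = c} ≤
      Cardinal.lift.{1} (Cardinal.mk L)) :
    ∃ f : (ℕ → ℕ) → (CardPoset lam → CardPoset κ),
      Monotone f ∧ ∀ g : CardPoset lam → CardPoset κ, ∃ α : ℕ → ℕ, g ≤ f α := by
  have hpos : 0 < κ.ord := Cardinal.ord_pos.2 hreg.pos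
  have : Nonempty (CardPoset κ) := ⟨⟨0, hpos⟩⟩
  obtain ⟨φ, hφ⟩ := exists_cofinal_enumeration hbig
  let s (x : ℕ → ℕ) (i : CardPoset lam) (y : {y : ℕ → ℕ // y ∈ L ∧ y ≤ x}) : Ordinal.{0} :=
    φ ⟨y, y.2.1⟩ i
  have hs (x i) : ⨆ y, s x i y < κ.ord :=
    Ordinal.iSup_lt_of_lt_cof (by rw [hreg.cof_ord]; exact hLusin x) fun y => (φ ⟨y, y.2.1⟩ i).2
  refine ⟨fun x i => ⟨⨆ y, s x i y, hs x i⟩, fun x x' hx i => ?_, fun g => ?_⟩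
  · exact Ordinal.iSup_le fun y => Ordinal.le_iSup (s x' i) ⟨y, y.2.1, y.2.2.trans hx⟩
  · obtain ⟨y, hy⟩ := hφ g
    exact ⟨y, fun i => (hy i).trans (Ordinal.le_iSup (s y i) ⟨y, y.2, le_rfl⟩)⟩
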